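/- Suppose the ℤ²-subshift X is polygonal with respect to an integer polygon P and P = n·P₀ (dilation by n about the origin) for some integer polygon P₀ and some integer n > 1. Then there is a recoding Y of X that is polygonal with respect to P₀; consequently m·P₀ is a coding polygon for Y for every positive integer m. -/

import Mathlib

namespace PolygonalShifts

abbrev Z2 : Type := ℤ × ℤ

abbrev Config (A : Type*) : Type _ := Z2 → A

/-- The translation action of `ℤ²` on configurations. -/
def shiftAct {A : Type*} (u : Z2) (x : Config A) : Config A := fun w => x (u + w)

/-- A `ℤ²`-subshift: a closed (for the product topology, with the alphabet discrete)
and translation-invariant set of configurations. -/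
def IsSubshift {A : Type*} (X : Set (Config A)) : Prop :=
  (letI : TopologicalSpace A := ⊥
   IsClosed X) ∧
  ∀ u : Z2, ∀ x ∈ X, shiftAct u x ∈ X

/-- The canonical embedding `ℤ² → ℝ²`. -/
def toR2 (p : Z2) : ℝ × ℝ := ((p.1 : ℝ), (p.2 : ℝ))

/-- `S` X-codes `S'`, for subsets `S, S'` of `ℝ²`. -/
def Codes {A : Type*} (X : Set (Config A)) (S S' : Set (ℝ × ℝ)) : Prop :=
  ∀ x ∈ X, ∀ x' ∈ X,
    (∀ p : Z2, toR2 p ∈ S → x p = x' p) →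
    ∀ p : Z2, toR2 p ∈ S' → x p = x' p

/-- `S` X-codes `S'`, for subsets `S, S'` of `ℤ²`. -/
def CodesZ {A : Type*} (X : Set (Config A)) (S S' : Set Z2) : Prop :=
  ∀ x ∈ X, ∀ x' ∈ X, (∀ p ∈ S, x p = x' p) → ∀ p ∈ S', x p = x' p

/-- `Y` is a recoding of `X` via the finite set `F ⊆ ℤ²`. -/
def IsRecodingVia {A A' : Type*} (X : Set (Config A)) (Y : Set (Config A'))
    (F : Set Z2) : Prop :=
  letI : TopologicalSpace A := ⊥
  letI : TopologicalSpace A' := ⊥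
  ∃ Ψ : X ≃ₜ Y,
    (∀ (u : Z2) (x x' : X), (x' : Config A) = shiftAct u (x : Config A) →
      (↑(Ψ x') : Config A') = shiftAct u (↑(Ψ x) : Config A')) ∧
    (∀ (u : Z2) (x x' : X),
      (↑(Ψ x) : Config A') u = (↑(Ψ x') : Config A') u ↔
        ∀ f ∈ F, (x : Config A) (f + u) = (x' : Config A) (f + u))

/-- `Y` is a recoding of `X`. -/
def IsRecoding {A A' : Type*} (X : Set (Config A)) (Y : Set (Config A')) : Prop :=
  ∃ F : Set Z2, F.Finite ∧ IsRecodingVia X Y F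

/-- Integer cross product. -/
def crossZ (u v : Z2) : ℤ := u.1 * v.2 - u.2 * v.1

/-- Real cross product. -/
def crossR (u v : ℝ × ℝ) : ℝ := u.1 * v.2 - u.2 * v.1

/-- A convex integer polygon, given by its (at least three) vertices listed in
counterclockwise order: every vertex lies strictly to the left of every directed edge. -/
structure IntPolygon where
  n : ℕ
  vert : Fin (n + 3) → Z2
  convex : ∀ i j : Fin (n + 3), j ≠ i → j ≠ i + 1 →
    0 < crossZ (vert (i + 1) - vert i) (vert j - vert i)

namespace IntPolygon

/-- The oriented edge vector from vertex `i` to vertex `i+1`. -/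
def edgeVec (P : IntPolygon) (i : Fin (P.n + 3)) : Z2 := P.vert (i + 1) - P.vert i

/-- The polygon as a subset of `ℝ²` (the convex hull of its vertices). -/
def carrier (P : IntPolygon) : Set (ℝ × ℝ) :=
  convexHull ℝ (Set.range fun i => toR2 (P.vert i))

lemma crossZ_smul (m : ℤ) (u v : Z2) : crossZ (m • u) (m • v) = m ^ 2 * crossZ u v := by
  simp only [crossZ, Prod.smul_fst, Prod.smul_snd, smul_eq_mul]
  ring

/-- The dilation of a polygon by a positive integer factor about the origin. -/
def dilate (P : IntPolygon) (m : ℤ) (hm : 0 < m) : IntPolygon where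
  n := P.n
  vert := fun i => m • P.vert i
  convex := by
    intro i j hj hj1
    have h := P.convex i j hj hj1
    have e1 : m • P.vert (i + 1) - m • P.vert i = m • (P.vert (i + 1) - P.vert i) :=
      (smul_sub m _ _).symm
    have e2 : m • P.vert j - m • P.vert i = m • (P.vert j - P.vert i) :=
      (smul_sub m _ _).symm
    rw [e1, e2, crossZ_smul]
    exact mul_pos (pow_pos hm 2) h

end IntPolygon

/-- `P` is a coding polygon for `X`: for each vertex `w`, the polygon with `w`
removed X-codes `w`. -/
def IsCodingPolygon {A : Type*} (X : Set (Config A)) (P : IntPolygon) : Prop :=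
  ∀ i : Fin (P.n + 3),
    Codes X (P.carrier \ {toR2 (P.vert i)}) {toR2 (P.vert i)}

/-- `X` is polygonal with respect to `P`. -/
def Polygonal {A : Type*} (X : Set (Config A)) (P : IntPolygon) : Prop :=
  X.Infinite ∧ IsCodingPolygon X P

/-- The closed half plane `H_v = {w : v₁ w₂ − v₂ w₁ ≥ 0}` to the left of the direction `v`. -/
def leftHalfPlane (v : ℝ × ℝ) : Set (ℝ × ℝ) := {w | 0 ≤ v.1 * w.2 - v.2 * w.1}

/-- The ray directed by `v` is expansive for `X`: `H_v` X-codes all of `ℝ²`. -/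
def ExpansiveRay {A : Type*} (X : Set (Config A)) (v : ℝ × ℝ) : Prop :=
  Codes X (leftHalfPlane v) Set.univ

/-- For a primitive integer direction `v`, the line `L₀`: the translate of `L = ℝ·v`
by an integer vector, lying outside `H_v` and closest to `L`. -/
def lineL0 (v : Z2) : Set (ℝ × ℝ) := {w | (v.1 : ℝ) * w.2 - (v.2 : ℝ) * w.1 = -1}

/-- A block of `m` consecutive lattice points on `L₀`, starting at `z`. -/
def blockOn (v z : Z2) (m : ℕ) : Set (ℝ × ℝ) :=
  (fun k : ℕ => toR2 (z + (k : ℤ) • v)) '' {k | k < m}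

/-- The (nonexpansive) rational ray directed by the primitive vector `v` is closing for `X`. -/
def ClosingRay {A : Type*} (X : Set (Config A)) (v : Z2) : Prop :=
  ∃ N : ℕ, ∀ z : Z2, v.1 * z.2 - v.2 * z.1 = -1 →
    ∀ m : ℕ, N ≤ m →
      Codes X (leftHalfPlane (toR2 v) ∪ blockOn v z m) (lineL0 v)

/-- The sector (with vertex the origin) determined by the rays through `e₁` and `e₂`:
lattice points on either ray or strictly between them. -/
def SectorZ (e₁ e₂ : Z2) : Set Z2 :=
  {p | SameRay ℝ (toR2 e₁) (toR2 p) ∨ SameRay ℝ (toR2 e₂) (toR2 p) ∨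
       (0 < crossZ e₁ p ∧ 0 < crossZ p e₂)}

/-- The rational sector determined by `(e₁, e₂)` is corner coding for `X`. -/
def IsCornerCoding {A : Type*} (X : Set (Config A)) (e₁ e₂ : Z2) : Prop :=
  CodesZ X (SectorZ e₁ e₂ \ {0}) {0}

/-- The rational sector determined by `(e₁, e₂)` is weakly corner coding for `X`. -/
def IsWeaklyCornerCoding {A : Type*} (X : Set (Config A)) (e₁ e₂ : Z2) : Prop :=
  ∃ F₀ : Set Z2, F₀.Finite ∧ F₀ ⊆ SectorZ e₁ e₂ ∧
    ∀ F : Set Z2, F.Finite → F ⊆ SectorZ e₁ e₂ →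
      CodesZ X (SectorZ e₁ e₂ \ F) (SectorZ e₁ e₂ \ F₀)

/-- The sector based at the vertex `i` of the polygon `P`: lattice points in the convex
cone with apex `P.vert i` spanned by the two edges of `P` incident to that vertex. -/
def vertexSector (P : IntPolygon) (i : Fin (P.n + 3)) : Set Z2 :=
  {p | ∃ s t : ℝ, 0 ≤ s ∧ 0 ≤ t ∧
    toR2 p = toR2 (P.vert i) + s • toR2 (P.vert (i - 1) - P.vert i)
      + t • toR2 (P.vert (i + 1) - P.vert i)}

/-- `P` is a coding polygon for some recoding of `X`. -/
def HasRecodingPolygon {A : Type*} (X : Set (Config A)) (P : IntPolygon) : Prop :=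
  ∃ (A' : Type) (_ : Fintype A') (Y : Set (Config A')),
    IsSubshift Y ∧ IsRecoding X Y ∧ IsCodingPolygon Y P

/-- `P` is a minimal recoding polygon for `X`. -/
def IsMinimalRecodingPolygon {A : Type*} (X : Set (Config A)) (P : IntPolygon) : Prop :=
  HasRecodingPolygon X P ∧
  (∀ Q : IntPolygon, HasRecodingPolygon X Q → P.n ≤ Q.n) ∧
  (∀ Q : IntPolygon, HasRecodingPolygon X Q → Q.n = P.n →
    Q.carrier ⊆ P.carrier → Q.carrier = P.carrier)

lemma toR2_add (p q : Z2) : toR2 (p + q) = toR2 p + toR2 q := by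
  simp [toR2]

lemma toR2_sub (p q : Z2) : toR2 (p - q) = toR2 p - toR2 q := by
  simp [toR2]

lemma toR2_zsmul (m : ℤ) (p : Z2) : toR2 (m • p) = (m : ℝ) • toR2 p := by
  simp [toR2]

lemma toR2_injective : Function.Injective toR2 := by
  rintro ⟨a, b⟩ ⟨c, d⟩ h
  simpa [toR2] using h

namespace IntPolygon

/-- `q` is a lattice point of the real dilation `t • P`, written in terms of vertex weights. -/
def InDilation (P : IntPolygon) (t : ℝ) (q : Z2) : Prop :=
  ∃ c : Fin (P.n + 3) → ℝ, (∀ j, 0 ≤ c j) ∧ ∑ j, c j = t ∧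
    ∑ j, c j • toR2 (P.vert j) = toR2 q

variable {P : IntPolygon}

lemma inDilation_one_iff {q : Z2} : P.InDilation 1 q ↔ toR2 q ∈ P.carrier := by
  constructor
  · rintro ⟨c, h0, h1, hq⟩
    rw [← hq]
    exact (convex_convexHull ℝ _).sum_mem (fun j _ => h0 j) h1
      (fun j _ => subset_convexHull ℝ _ ⟨j, rfl⟩)
  · intro h
    have hconv : Convex ℝ {z : ℝ × ℝ | ∃ c : Fin (P.n + 3) → ℝ, (∀ j, 0 ≤ c j) ∧
        ∑ j, c j = 1 ∧ ∑ j, c j • toR2 (P.vert j) = z} := by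
      rintro x ⟨c, c0, c1, rfl⟩ y ⟨d, d0, d1, rfl⟩ a b ha hb hab
      refine ⟨fun j => a * c j + b * d j,
        fun j => add_nonneg (mul_nonneg ha (c0 j)) (mul_nonneg hb (d0 j)), ?_, ?_⟩
      · rw [Finset.sum_add_distrib, ← Finset.mul_sum, ← Finset.mul_sum, c1, d1, mul_one, mul_one,
          hab]
      · simp only [add_smul, mul_smul, Finset.sum_add_distrib, Finset.smul_sum]
    refine convexHull_min ?_ hconv h
    rintro _ ⟨i, rfl⟩
    exact ⟨Pi.single i 1, fun j => by by_cases hj : j = i <;> simp [hj],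
      by simp, by simp [Pi.single_apply]⟩

lemma mem_carrier_dilate_iff {m : ℤ} (hm : 0 < m) {q : Z2} :
    toR2 q ∈ (P.dilate m hm).carrier ↔ P.InDilation m q := by
  have hm' : (0 : ℝ) < m := by exact_mod_cast hm
  have hdil : (P.dilate m hm).InDilation 1 q ↔ ∃ c : Fin (P.n + 3) → ℝ, (∀ j, 0 ≤ c j) ∧
      ∑ j, c j = 1 ∧ ∑ j, c j • toR2 (m • P.vert j) = toR2 q := Iff.rfl
  rw [← inDilation_one_iff, hdil]
  simp only [toR2_zsmul, smul_smul]
  constructor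
  · rintro ⟨c, h0, h1, hq⟩
    exact ⟨fun j => c j * m, fun j => mul_nonneg (h0 j) hm'.le,
      by rw [← Finset.sum_mul, h1, one_mul], hq⟩
  · rintro ⟨c, h0, h1, hq⟩
    exact ⟨fun j => c j / m, fun j => div_nonneg (h0 j) hm'.le,
      by rw [← Finset.sum_div, h1, div_self hm'.ne'],
      by simpa only [div_mul_cancel₀ _ hm'.ne'] using hq⟩

lemma InDilation.add {s t : ℝ} {p q : Z2} (hp : P.InDilation s p) (hq : P.InDilation t q) :
    P.InDilation (s + t) (p + q) := by
  obtain ⟨c, c0, c1, hc⟩ := hp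
  obtain ⟨d, d0, d1, hd⟩ := hq
  exact ⟨fun j => c j + d j, fun j => add_nonneg (c0 j) (d0 j),
    by rw [Finset.sum_add_distrib, c1, d1],
    by simp only [add_smul, Finset.sum_add_distrib, hc, hd, toR2_add]⟩

lemma inDilation_zsmul_vert (i : Fin (P.n + 3)) {m : ℤ} (hm : 0 ≤ m) :
    P.InDilation m (m • P.vert i) :=
  ⟨Pi.single i (m : ℝ), fun j => by by_cases hj : j = i <;> simp [hj, hm],
    by simp, by simp [Pi.single_apply, toR2_zsmul, -zsmul_eq_mul]⟩

lemma inDilation_vert (i : Fin (P.n + 3)) : P.InDilation 1 (P.vert i) := by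
  simpa using inDilation_zsmul_vert (P := P) i zero_le_one

lemma sub_zsmul_vert_inDilation {c : Fin (P.n + 3) → ℝ} (h0 : ∀ j, 0 ≤ c j) {q : Z2}
    (hq : ∑ j, c j • toR2 (P.vert j) = toR2 q) {i : Fin (P.n + 3)} {m : ℤ} (hm : (m : ℝ) ≤ c i) :
    P.InDilation (∑ j, c j - m) (q - m • P.vert i) := by
  refine ⟨fun j => c j - (Pi.single i (m : ℝ) : Fin (P.n + 3) → ℝ) j, fun j => ?_, ?_, ?_⟩
  · by_cases hj : j = i
    · subst hj
      simpa using hm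
    · simpa [hj] using h0 j
  · simp
  · simp [sub_smul, hq, toR2_sub, toR2_zsmul, Pi.single_apply, -zsmul_eq_mul]

lemma finite_inDilation (P : IntPolygon) (t : ℝ) : {q : Z2 | P.InDilation t q}.Finite := by
  have key : ∀ (c f : Fin (P.n + 3) → ℝ), (∀ j, 0 ≤ c j) →
      |∑ j, c j * f j| ≤ (∑ j, c j) * ∑ j, |f j| := by
    intro c f h0
    calc |∑ j, c j * f j| ≤ ∑ j, |c j * f j| := Finset.abs_sum_le_sum_abs _ _
      _ = ∑ j, c j * |f j| := by simp_rw [abs_mul, abs_of_nonneg (h0 _)]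
      _ ≤ ∑ j, c j * ∑ k, |f k| := Finset.sum_le_sum fun j _ =>
          mul_le_mul_of_nonneg_left
            (Finset.single_le_sum (f := fun k => |f k|) (fun k _ => abs_nonneg _)
              (Finset.mem_univ j)) (h0 j)
      _ = _ := (Finset.sum_mul _ _ _).symm
  have coord : ∀ (g : Z2 → ℤ),
      (∀ q, P.InDilation t q → ∃ c : Fin (P.n + 3) → ℝ, (∀ j, 0 ≤ c j) ∧ ∑ j, c j = t ∧
        ∑ j, c j * (g (P.vert j) : ℝ) = g q) →
      ∃ M : ℤ, ∀ q, P.InDilation t q → -M ≤ g q ∧ g q ≤ M := by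
    intro g hg
    refine ⟨⌈t * ∑ j, |(g (P.vert j) : ℝ)|⌉, fun q hq => abs_le.mp ?_⟩
    obtain ⟨c, h0, rfl, hc⟩ := hg q hq
    have := key c (fun j => (g (P.vert j) : ℝ)) h0
    rw [hc] at this
    exact_mod_cast this.trans (Int.le_ceil _)
  obtain ⟨M, hM⟩ := coord Prod.fst (by
    rintro q ⟨c, h0, h1, h⟩
    exact ⟨c, h0, h1, by simpa [toR2, Prod.fst_sum] using congrArg Prod.fst h⟩)
  obtain ⟨N, hN⟩ := coord Prod.snd (by
    rintro q ⟨c, h0, h1, h⟩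
    exact ⟨c, h0, h1, by simpa [toR2, Prod.snd_sum] using congrArg Prod.snd h⟩)
  exact ((Set.finite_Icc (-M) M).prod (Set.finite_Icc (-N) N)).subset
    fun q hq => ⟨hM q hq, hN q hq⟩

/-- The integer linear form whose minimum over the polygon is attained exactly at vertex `i`. -/
def cornerForm (P : IntPolygon) (i : Fin (P.n + 3)) (p : Z2) : ℤ :=
  crossZ (P.vert (i + 1) - P.vert (i - 1)) p

lemma cornerForm_lt (P : IntPolygon) {i j : Fin (P.n + 3)} (hj : j ≠ i) :
    P.cornerForm i (P.vert i) < P.cornerForm i (P.vert j) := by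
  have two : (1 : Fin (P.n + 3)) + 1 ≠ 0 := by
    intro h
    have := congrArg Fin.val h
    rw [Fin.val_add] at this
    simp [Nat.mod_eq_of_lt (show 1 + 1 < P.n + 3 by omega)] at this
  have next : j = i + 1 ∨
      0 < crossZ (P.vert (i + 1) - P.vert i) (P.vert j - P.vert i) :=
    or_iff_not_imp_left.mpr (P.convex i j hj)
  have prev : j = i - 1 ∨
      0 < crossZ (P.vert i - P.vert (i - 1)) (P.vert j - P.vert (i - 1)) := by
    refine or_iff_not_imp_left.mpr fun h => ?_
    have := P.convex (i - 1) j h (by rwa [sub_add_cancel])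
    rwa [sub_add_cancel] at this
  have distinct : i + 1 ≠ i - 1 := by
    intro h
    apply two
    have : i + (1 + 1) = i := by rw [← add_assoc, h, sub_add_cancel]
    simpa using this
  simp only [cornerForm, crossZ, Prod.fst_sub, Prod.snd_sub] at next prev ⊢
  rcases next with rfl | next
  · rcases prev with h | prev
    · exact absurd h distinct
    · linarith
  · rcases prev with rfl | prev
    · linarith
    · linarith

lemma vert_injective (P : IntPolygon) : Function.Injective P.vert := by
  intro i j h
  by_contra hij
  have := P.cornerForm_lt (i := i) (j := j) (Ne.symm hij)
  rw [h] at this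
  exact lt_irrefl _ this

lemma cornerForm_lt_of_inDilation {i : Fin (P.n + 3)} {m : ℤ} {p : Z2} (hp : P.InDilation m p)
    (hne : p ≠ m • P.vert i) : P.cornerForm i (m • P.vert i) < P.cornerForm i p := by
  obtain ⟨c, h0, h1, hq⟩ := hp
  have hpos : ∃ j, j ≠ i ∧ 0 < c j := by
    by_contra! hcon
    have hz : ∀ j, j ≠ i → c j = 0 := fun j hj => le_antisymm (hcon j hj) (h0 j)
    apply hne
    apply toR2_injective
    rw [← hq, toR2_zsmul, ← h1, Finset.sum_eq_single i (fun j _ hj => hz j hj) (by simp),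
      Finset.sum_eq_single i (fun j _ hj => by simp [hz j hj]) (by simp)]
  have hform : ∑ j, c j * ((P.cornerForm i (P.vert j) : ℝ) - P.cornerForm i (P.vert i)) =
      (P.cornerForm i p : ℝ) - P.cornerForm i (m • P.vert i) := by
    have e1 : ∑ j, c j * ((P.vert j).1 : ℝ) = p.1 := by
      simpa [toR2, Prod.fst_sum] using congrArg Prod.fst hq
    have e2 : ∑ j, c j * ((P.vert j).2 : ℝ) = p.2 := by
      simpa [toR2, Prod.snd_sum] using congrArg Prod.snd hq
    simp only [cornerForm, crossZ, Prod.smul_fst, Prod.smul_snd, smul_eq_mul]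
    push_cast
    rw [← e1, ← e2, ← h1]
    simp only [Finset.mul_sum, Finset.sum_mul, ← Finset.sum_sub_distrib]
    exact Finset.sum_congr rfl fun j _ => by ring
  have hsum : 0 < ∑ j, c j * ((P.cornerForm i (P.vert j) : ℝ) - P.cornerForm i (P.vert i)) := by
    have hlt : ∀ j, j ≠ i → (0 : ℝ) < P.cornerForm i (P.vert j) - P.cornerForm i (P.vert i) :=
      fun j hj => sub_pos.mpr (by exact_mod_cast P.cornerForm_lt hj)
    obtain ⟨j, hj, hcj⟩ := hpos
    refine Finset.sum_pos' (fun k _ => mul_nonneg (h0 k) ?_)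
      ⟨j, Finset.mem_univ j, mul_pos hcj (hlt j hj)⟩
    by_cases hk : k = i
    · simp [hk]
    · exact (hlt k hk).le
  rw [hform, sub_pos] at hsum
  exact_mod_cast hsum

end IntPolygon

lemma codes_vertex_translate {A : Type*} {X : Set (Config A)}
    (hshift : ∀ u : Z2, ∀ x ∈ X, shiftAct u x ∈ X) {P : IntPolygon} (h : IsCodingPolygon X P)
    (i : Fin (P.n + 3)) (u : Z2) {x x' : Config A} (hx : x ∈ X) (hx' : x' ∈ X)
    (hagree : ∀ p : Z2, toR2 p ∈ P.carrier → p ≠ P.vert i → x (u + p) = x' (u + p)) :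
    x (u + P.vert i) = x' (u + P.vert i) :=
  h i _ (hshift u x hx) _ (hshift u x' hx')
    (fun p hp => hagree p hp.1 fun hpi => hp.2 (congrArg toR2 hpi)) (P.vert i) rfl

lemma IsCodingPolygon.dilate {A : Type*} {X : Set (Config A)}
    (hshift : ∀ u : Z2, ∀ x ∈ X, shiftAct u x ∈ X) {P : IntPolygon} (h : IsCodingPolygon X P)
    (m : ℤ) (hm : 0 < m) : IsCodingPolygon X (P.dilate m hm) := by
  intro i x hx x' hx' hagree p hp
  obtain rfl : p = m • P.vert i := toR2_injective hp
  have hsplit : m • P.vert i = (m - 1) • P.vert i + P.vert i := by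
    rw [sub_smul, one_smul, sub_add_cancel]
  rw [hsplit]
  refine codes_vertex_translate hshift h i _ hx hx' fun p hp hpi => hagree _ ⟨?_, fun he => ?_⟩
  · rw [IntPolygon.mem_carrier_dilate_iff]
    have hm1 : 0 ≤ m - 1 := by omega
    have := (IntPolygon.inDilation_zsmul_vert (P := P) i hm1).add
      (IntPolygon.inDilation_one_iff.mpr hp)
    simpa using this
  · have he' : (m - 1) • P.vert i + p = m • P.vert i := toR2_injective he
    rw [hsplit] at he'
    exact hpi (add_left_cancel he')

/-- Agreement on `P + k • P`, omitting one vertex of the first summand, propagates to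
`(k + 1) • P` when `k` is large compared to a dilation factor for which `P` is coding. -/
lemma agree_of_agree_on_sum {A : Type*} {X : Set (Config A)}
    (hshift : ∀ u : Z2, ∀ x ∈ X, shiftAct u x ∈ X) {P : IntPolygon} {n : ℤ} (hn : 0 < n)
    (h : IsCodingPolygon X (P.dilate n hn)) (i : Fin (P.n + 3)) {k : ℝ}
    (hk : (n : ℝ) + (P.n + 3 : ℕ) ≤ k) {x x' : Config A} (hx : x ∈ X) (hx' : x' ∈ X)
    (hagree : ∀ j, j ≠ i → ∀ f, P.InDilation k f → x (f + P.vert j) = x' (f + P.vert j))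
    {q : Z2} (hq : P.InDilation (k + 1) q) : x q = x' q := by
  by_contra hne
  obtain ⟨q, ⟨hq, hne⟩, hmax⟩ := Set.exists_max_image
    {q : Z2 | P.InDilation (k + 1) q ∧ x q ≠ x' q} (P.cornerForm i)
    ((P.finite_inDilation (k + 1)).subset fun q hq => hq.1) ⟨q, hq, hne⟩
  obtain ⟨c, h0, h1, hc⟩ := hq
  have hsmall : ∀ j, j ≠ i → c j < 1 := by
    intro j hj
    by_contra! hcj
    have := IntPolygon.sub_zsmul_vert_inDilation h0 hc (i := j) (m := 1) (by exact_mod_cast hcj)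
    rw [h1] at this
    refine hne ?_
    simpa using hagree j hj (q - P.vert j) (by simpa using this)
  have hlarge : (n : ℝ) ≤ c i := by
    have hle : ∑ j ∈ Finset.univ.erase i, c j ≤ (P.n + 3 : ℕ) := by
      calc ∑ j ∈ Finset.univ.erase i, c j ≤ ∑ j ∈ Finset.univ.erase i, (1 : ℝ) :=
            Finset.sum_le_sum fun j hj => (hsmall j (Finset.ne_of_mem_erase hj)).le
        _ ≤ ∑ j : Fin (P.n + 3), (1 : ℝ) :=
            Finset.sum_le_sum_of_subset_of_nonneg (Finset.erase_subset _ _) (by simp)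
        _ = (P.n + 3 : ℕ) := by simp
    have hadd := Finset.add_sum_erase Finset.univ c (Finset.mem_univ i)
    linarith
  have hrest := IntPolygon.sub_zsmul_vert_inDilation h0 hc hlarge
  rw [h1] at hrest
  refine hne ?_
  have := codes_vertex_translate hshift h i (q - n • P.vert i) hx hx' fun p hp hpi => ?_
  · change x (q - n • P.vert i + n • P.vert i) = x' (q - n • P.vert i + n • P.vert i) at this
    simpa using this
  · rw [IntPolygon.mem_carrier_dilate_iff] at hp
    by_contra hpne
    have hmem := hrest.add hp
    rw [sub_add_cancel] at hmem
    have hle := hmax _ ⟨hmem, hpne⟩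
    have hlt := IntPolygon.cornerForm_lt_of_inDilation hp hpi
    simp only [IntPolygon.cornerForm, crossZ, Prod.fst_sub, Prod.snd_sub, Prod.fst_add,
      Prod.snd_add] at hle hlt
    linarith

/-- The sliding block code with window `F` and local rule `φ`. -/
def blockCode {A A' : Type*} (F : Set Z2) (φ : (F → A) → A') (x : Config A) : Config A' :=
  fun u => φ fun f => x (f + u)

section BlockCode

variable {A A' : Type*} {F : Set Z2} {φ : (F → A) → A'}

lemma blockCode_shiftAct (u : Z2) (x : Config A) :
    blockCode F φ (shiftAct u x) = shiftAct u (blockCode F φ x) := by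
  funext w
  simp [blockCode, shiftAct, add_left_comm]

lemma blockCode_apply_eq_iff (hφ : Function.Injective φ) (x x' : Config A) (u : Z2) :
    blockCode F φ x u = blockCode F φ x' u ↔ ∀ f ∈ F, x (f + u) = x' (f + u) := by
  rw [blockCode, blockCode, hφ.eq_iff, funext_iff]
  simp

lemma blockCode_injective (hφ : Function.Injective φ) (hF : F.Nonempty) :
    Function.Injective (blockCode F φ) := by
  intro x x' h
  obtain ⟨f, hf⟩ := hF
  funext w
  simpa using (blockCode_apply_eq_iff hφ x x' (w - f)).mp (congrFun h _) f hf

lemma continuous_blockCode [TopologicalSpace A] [DiscreteTopology A] [TopologicalSpace A']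
    (hF : F.Finite) : Continuous (blockCode F φ) := by
  have := hF.to_subtype
  refine continuous_pi fun u => ?_
  exact (continuous_of_discreteTopology (f := φ)).comp
    (continuous_pi fun f => continuous_apply (f.1 + u))

lemma isSubshift_image_blockCode [Finite A] {X : Set (Config A)} (hX : IsSubshift X)
    (hF : F.Finite) : IsSubshift (blockCode F φ '' X) := by
  refine ⟨?_, ?_⟩
  · let _ : TopologicalSpace A := ⊥
    let _ : TopologicalSpace A' := ⊥
    have : DiscreteTopology A := ⟨rfl⟩
    have : DiscreteTopology A' := ⟨rfl⟩
    have hclosed : IsClosed X := hX.1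
    exact (hclosed.isCompact.image (continuous_blockCode hF)).isClosed
  · rintro u _ ⟨x, hx, rfl⟩
    exact ⟨shiftAct u x, hX.2 u x hx, blockCode_shiftAct u x⟩

lemma isRecoding_image_blockCode [Finite A] {X : Set (Config A)} (hX : IsSubshift X)
    (hF : F.Finite) (hne : F.Nonempty) (hφ : Function.Injective φ) :
    IsRecoding X (blockCode F φ '' X) := by
  refine ⟨F, hF, ?_⟩
  let _ : TopologicalSpace A := ⊥
  let _ : TopologicalSpace A' := ⊥
  have : DiscreteTopology A := ⟨rfl⟩
  have : DiscreteTopology A' := ⟨rfl⟩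
  have hclosed : IsClosed X := hX.1
  have : CompactSpace X := isCompact_iff_compactSpace.mp hclosed.isCompact
  let e : X ≃ (blockCode F φ '' X) := Equiv.Set.image _ X (blockCode_injective hφ hne)
  have he : Continuous e :=
    ((continuous_blockCode hF).comp continuous_subtype_val).subtype_mk _
  refine ⟨he.homeoOfEquivCompactToT2, fun u x x' h => ?_,
    fun u x x' => blockCode_apply_eq_iff hφ _ _ u⟩
  change blockCode F φ x' = shiftAct u (blockCode F φ x)
  rw [h, blockCode_shiftAct]

end BlockCode

/-- if `X` is polygonal with respect to `n·P₀` with `n > 1`, then some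
recoding `Y` of `X` is polygonal with respect to `P₀`, and `m·P₀` is a coding polygon
for `Y` for every positive integer `m`. -/
theorem statement5 {A : Type} [Fintype A] [Nonempty A] (X : Set (Config A))
    (hX : IsSubshift X) (P₀ : IntPolygon) (n : ℤ) (hn : 1 < n)
    (h : Polygonal X (P₀.dilate n (by omega))) :
    ∃ (A' : Type) (_ : Fintype A') (Y : Set (Config A')),
      IsSubshift Y ∧ IsRecoding X Y ∧ Polygonal Y P₀ ∧
      ∀ m : ℤ, ∀ hm : 0 < m, IsCodingPolygon Y (P₀.dilate m hm) := by
  have hn0 : 0 < n := by omega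
  set k : ℤ := n + (P₀.n + 3 : ℕ) with hk
  have hk0 : 0 ≤ k := by omega
  let F : Set Z2 := {f | P₀.InDilation k f}
  have hF : F.Finite := P₀.finite_inDilation k
  have hne : F.Nonempty := ⟨_, IntPolygon.inDilation_zsmul_vert 0 hk0⟩
  have : Finite F := hF.to_subtype
  let φ : (F → A) → (F → A) := id
  have hφ : Function.Injective φ := Function.injective_id
  have hY := isSubshift_image_blockCode (φ := φ) hX hF
  have hcoding : IsCodingPolygon (blockCode F φ '' X) P₀ := by
    rintro i _ ⟨x, hx, rfl⟩ _ ⟨x', hx', rfl⟩ hagree p hp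
    obtain rfl : p = P₀.vert i := toR2_injective hp
    rw [blockCode_apply_eq_iff hφ]
    intro f hf
    refine agree_of_agree_on_sum hX.2 hn0 h.2 i (k := k) (by rw [hk]; push_cast; rfl) hx hx'
      (fun j hj g hg => ?_) (IntPolygon.InDilation.add hf (IntPolygon.inDilation_vert i))
    exact (blockCode_apply_eq_iff hφ x x' (P₀.vert j)).mp
      (hagree _ ⟨subset_convexHull ℝ _ ⟨j, rfl⟩,
        fun he => hj (P₀.vert_injective (toR2_injective he))⟩) g hg
  exact ⟨F → A, Fintype.ofFinite _, blockCode F φ '' X, hY,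
    isRecoding_image_blockCode hX hF hne hφ,
    ⟨h.1.image (blockCode_injective hφ hne).injOn, hcoding⟩,
    fun m hm => hcoding.dilate hY.2 m hm⟩

end PolygonalShifts
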